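/- arXiv:1812.10926 — 3 statements merged into one kernel-verified Lean document; each statement's English description precedes it below -/
import Mathlib

section
/- (Lemma 1) Let W be an ≺-extension of an itemset X in a database D, and suppose Γ_W is nonempty. Then uo(W) ≤ (Σ_{T ∈ Γ_W} (uo(X,T) + ruo(X,T))) / |Γ_W|. -/
open Finset

/-- Transaction utility: total utility of all items in transaction `T`. -/
noncomputable def tu {ι τ : Type*} (items : τ → Finset ι) (u : ι → τ → ℝ) (T : τ) : ℝ :=
  ∑ i ∈ items T, u i T

/-- Utility occupancy of an itemset `X` in a transaction `T`. -/
noncomputable def uo {ι τ : Type*} (items : τ → Finset ι) (u : ι → τ → ℝ)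
    (X : Finset ι) (T : τ) : ℝ :=
  (∑ i ∈ X, u i T) / tu items u T

/-- Remaining utility occupancy of an itemset `X` in a transaction `T`. -/
noncomputable def ruo {ι τ : Type*} [LinearOrder ι] (items : τ → Finset ι) (u : ι → τ → ℝ)
    (X : Finset ι) (T : τ) : ℝ :=
  (∑ i ∈ (items T).filter (fun j => ∀ x ∈ X, x < j), u i T) / tu items u T

/-- Supporting transactions of itemset `X` in database `D`. -/
def supTrans {ι τ : Type*} [DecidableEq ι] (items : τ → Finset ι) (D : Finset τ)
    (X : Finset ι) : Finset τ :=
  D.filter (fun T => X ⊆ items T)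

/-- Utility occupancy of an itemset `X` in a database `D`. -/
noncomputable def uoDB {ι τ : Type*} [DecidableEq ι] (items : τ → Finset ι) (u : ι → τ → ℝ)
    (D : Finset τ) (X : Finset ι) : ℝ :=
  (∑ T ∈ supTrans items D X, uo items u X T) / (supTrans items D X).card

/-- `W` is an `≺`-extension of `X`. -/
def IsExtension {ι : Type*} [LinearOrder ι] (X W : Finset ι) : Prop :=
  X ⊆ W ∧ ∀ x ∈ X, ∀ w ∈ W \ X, x < w

/-- In a transaction containing `W`, the utility occupancy of an extension `W` of `X` is at most
the sum of the utility occupancy and the remaining utility occupancy of `X`. -/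
theorem IsExtension.uo_le_uo_add_ruo {ι τ : Type*} [LinearOrder ι]
    {items : τ → Finset ι} {u : ι → τ → ℝ} {X W : Finset ι} {T : τ} (hext : IsExtension X W)
    (hW : W ⊆ items T) (hu : ∀ i ∈ items T, 0 ≤ u i T) :
    uo items u W T ≤ uo items u X T + ruo items u X T := by
  have hsub : W \ X ⊆ (items T).filter (fun j => ∀ x ∈ X, x < j) := fun w hw =>
    mem_filter.2 ⟨hW (mem_sdiff.1 hw).1, fun x hx => hext.2 x hx w hw⟩
  have hsum : ∑ i ∈ W \ X, u i T ≤
      ∑ i ∈ (items T).filter (fun j => ∀ x ∈ X, x < j), u i T :=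
    sum_le_sum_of_subset_of_nonneg hsub fun i hi _ => hu i (mem_filter.1 hi).1
  have htu : 0 ≤ tu items u T := sum_nonneg hu
  rw [uo, uo, ruo, ← add_div, ← sum_sdiff hext.1, add_comm]
  gcongr

/-- Lemma 1: `uo(W) ≤ (Σ_{T ∈ Γ_W} (uo(X,T) + ruo(X,T))) / |Γ_W|`. -/
theorem lemma1 {ι τ : Type*} [LinearOrder ι]
    (items : τ → Finset ι) (u : ι → τ → ℝ) (D : Finset τ)
    (hu : ∀ T ∈ D, ∀ i ∈ items T, 0 ≤ u i T) (htu : ∀ T ∈ D, 0 < tu items u T)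
    (X W : Finset ι) (hext : IsExtension X W)
    (hne : (supTrans items D W).Nonempty) :
    uoDB items u D W ≤
      (∑ T ∈ supTrans items D W, (uo items u X T + ruo items u X T)) /
        (supTrans items D W).card := by
  rw [uoDB]
  gcongr with T hT
  obtain ⟨hTD, hWT⟩ := mem_filter.1 hT
  exact hext.uo_le_uo_add_ruo hWT (hu T hTD)
end

section
/- Per-transaction step for the partial downward closure property: let X be an itemset, let i be an item with x ≺ i for every x ∈ X, let X' = X ∪ {i}, and let T be a transaction with X' ⊆ items(T). Then uo(X',T) + ruo(X',T) ≤ uo(X,T) + ruo(X,T). -/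
open Finset

/-- Per-transaction step for the partial downward closure property:
extending `X` by a single item `i` succeeding all items of `X` cannot increase
`uo + ruo` in any supporting transaction. -/
theorem uo_add_ruo_child_le {ι τ : Type*} [LinearOrder ι]
    (items : τ → Finset ι) (u : ι → τ → ℝ) (T : τ)
    (hu : ∀ j ∈ items T, 0 ≤ u j T) (htu : 0 < tu items u T)
    (X : Finset ι) (i : ι) (hi : ∀ x ∈ X, x < i)
    (hsub : insert i X ⊆ items T) :
    uo items u (insert i X) T + ruo items u (insert i X) T ≤
      uo items u X T + ruo items u X T := by
  have hiX : i ∉ X := fun h => lt_irrefl i (hi i h)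
  have hnot : i ∉ (items T).filter (fun j => ∀ x ∈ insert i X, x < j) := fun h =>
    lt_irrefl i ((mem_filter.mp h).2 i (mem_insert_self i X))
  have hle : ∑ j ∈ insert i ((items T).filter (fun j => ∀ x ∈ insert i X, x < j)), u j T ≤
      ∑ j ∈ (items T).filter (fun j => ∀ x ∈ X, x < j), u j T := by
    refine sum_le_sum_of_subset_of_nonneg (insert_subset ?_ ?_) ?_
    · exact mem_filter.mpr ⟨hsub (mem_insert_self i X), hi⟩
    · exact monotone_filter_right _ fun j _ h x hx => h x (mem_insert_of_mem hx)
    · exact fun j hj _ => hu j (mem_filter.mp hj).1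
  rw [sum_insert hnot] at hle
  unfold uo ruo
  rw [← add_div, ← add_div, sum_insert hiX]
  exact div_le_div_of_nonneg_right (by linarith) htu.le
end

section
/- (Theorem 2, partial downward closure property) Let X be an itemset in a database D, let i be an item with x ≺ i for every x ∈ X, and let X' = X ∪ {i} (so X' is a child of X in the FU-tree). Let m be a positive integer with m ≤ sup(X'). Then the utility-occupancy upper bound is antitone along this parent–child relation: Top_m(T ↦ uo(X',T) + ruo(X',T), Γ_{X'}) / m ≤ Top_m(T ↦ uo(X,T) + ruo(X,T), Γ_X) / m. In particular, if the upper bound of the parent X is below a threshold β, so is the upper bound of every descendant in the subtree rooted at X. -/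
open Finset

/-- `topSum k v S`: the maximum of `Σ_{s ∈ A} v s` over all `k`-element subsets
`A ⊆ S` (the sum of the `k` largest values of `v` on `S`). -/
noncomputable def topSum {α : Type*} (k : ℕ) (v : α → ℝ) (S : Finset α) : ℝ :=
  sSup ((fun A : Finset α => ∑ s ∈ A, v s) '' {A : Finset α | A ⊆ S ∧ A.card = k})

theorem le_topSum {α : Type*} {v : α → ℝ} {S A : Finset α} (hA : A ⊆ S) :
    ∑ s ∈ A, v s ≤ topSum A.card v S := by
  refine le_csSup (Set.Finite.bddAbove (Set.Finite.image _ ?_)) ⟨A, ⟨hA, rfl⟩, rfl⟩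
  exact S.powerset.finite_toSet.subset fun B hB => by simpa using hB.1

theorem topSum_mono {α : Type*} {k : ℕ} {v w : α → ℝ} {S S' : Finset α} (hS : S ⊆ S')
    (hvw : ∀ s ∈ S, v s ≤ w s) (hk : k ≤ S.card) : topSum k v S ≤ topSum k w S' := by
  obtain ⟨B, hB, hBk⟩ := exists_subset_card_eq hk
  refine csSup_le ⟨_, B, ⟨hB, hBk⟩, rfl⟩ ?_
  rintro _ ⟨A, ⟨hA, rfl⟩, rfl⟩
  exact (sum_le_sum fun s hs => hvw s (hA hs)).trans (le_topSum (hA.trans hS))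

theorem supTrans_anti {ι τ : Type*} [DecidableEq ι] {items : τ → Finset ι} {D : Finset τ}
    {X Y : Finset ι} (h : X ⊆ Y) : supTrans items D Y ⊆ supTrans items D X :=
  monotone_filter_right D fun _ _ hY => h.trans hY

/-- Every item counted for `insert i X` is counted for `X`, since `i` itself comes after `X`. -/
theorem uo_add_ruo_insert_le {ι τ : Type*} [LinearOrder ι] {items : τ → Finset ι}
    {u : ι → τ → ℝ} {T : τ} (hu : ∀ j ∈ items T, 0 ≤ u j T) {X : Finset ι} {i : ι}
    (hi : ∀ x ∈ X, x < i) (hiT : i ∈ items T) :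
    uo items u (insert i X) T + ruo items u (insert i X) T ≤
      uo items u X T + ruo items u X T := by
  have hiX : i ∉ X := fun h => lt_irrefl i (hi i h)
  have hnot : i ∉ (items T).filter (fun j => ∀ x ∈ insert i X, x < j) := by simp
  have hsub : insert i ((items T).filter (fun j => ∀ x ∈ insert i X, x < j)) ⊆
      (items T).filter (fun j => ∀ x ∈ X, x < j) := by
    intro j hj
    simp only [mem_insert, mem_filter] at hj ⊢
    grind
  have hsum := sum_le_sum_of_subset_of_nonneg (f := fun j => u j T) hsub
    fun j hj _ => hu j (mem_filter.mp hj).1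
  rw [sum_insert hnot] at hsum
  unfold uo ruo
  rw [← add_div, ← add_div, sum_insert hiX]
  exact div_le_div_of_nonneg_right (by linarith) (sum_nonneg hu)

/-- Theorem 2 (partial downward closure): the utility-occupancy upper bound is
antitone along the parent–child relation of the FU-tree. -/
theorem partial_downward_closure {ι τ : Type*} [LinearOrder ι]
    (items : τ → Finset ι) (u : ι → τ → ℝ) (D : Finset τ)
    (hu : ∀ T ∈ D, ∀ j ∈ items T, 0 ≤ u j T) (htu : ∀ T ∈ D, 0 < tu items u T)
    (X : Finset ι) (i : ι) (hi : ∀ x ∈ X, x < i)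
    (m : ℕ) (hm1 : 1 ≤ m) (hm2 : m ≤ (supTrans items D (insert i X)).card) :
    topSum m (fun T => uo items u (insert i X) T + ruo items u (insert i X) T)
        (supTrans items D (insert i X)) / m ≤
      topSum m (fun T => uo items u X T + ruo items u X T) (supTrans items D X) / m := by
  refine div_le_div_of_nonneg_right (topSum_mono (supTrans_anti (subset_insert i X)) ?_ hm2)
    m.cast_nonneg
  intro T hT
  obtain ⟨hTD, hXT⟩ := mem_filter.mp hT
  exact uo_add_ruo_insert_le (hu T hTD) hi (hXT (mem_insert_self i X))
end
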